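/- Let μ₀ and μ be Borel probability measures on ℝ with point mass at least q at 0 and finite second moments, and set μ_θ = (1−θ)μ₀ + θμ for θ ∈ (0,1]. Then the weak (one-sided directional) derivative of the mutual information functional at μ₀ in the direction μ exists and equals lim_{θ→0⁺} (I(μ_θ) − I(μ₀))/θ = ∫ d(x;μ₀) dμ(x) − I(μ₀). -/

import Mathlib

open MeasureTheory Real Filter

/-- The standard Gaussian density `φ(t) = (2π)^{-1/2} e^{-t²/2}`. -/
noncomputable def gauss (t : ℝ) : ℝ := Real.exp (-t ^ 2 / 2) / Real.sqrt (2 * Real.pi)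

/-- The output density `p_Y(y;μ) = ∫ φ(y−x) dμ(x)`. -/
noncomputable def outDen (μ : Measure ℝ) (y : ℝ) : ℝ := ∫ x, gauss (y - x) ∂μ

/-- The relative entropy `d(x;μ) = ∫ φ(y−x) log(φ(y−x)/p_Y(y;μ)) dy`. -/
noncomputable def relEnt (x : ℝ) (μ : Measure ℝ) : ℝ :=
  ∫ y, gauss (y - x) * Real.log (gauss (y - x) / outDen μ y)

/-- The mutual information `I(μ) = ∫ d(x;μ) dμ(x)`. -/
noncomputable def mutInfo (μ : Measure ℝ) : ℝ := ∫ x, relEnt x μ ∂μ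

/-- The constraint set `Λ(γ,q)`: probability measures with `μ({0}) ≥ q` and second moment
at most `γ`. -/
def memLam (γ q : ℝ) (μ : Measure ℝ) : Prop :=
  IsProbabilityMeasure μ ∧ ENNReal.ofReal q ≤ μ {0} ∧
    ∫⁻ x, ENNReal.ofReal (x ^ 2) ∂μ ≤ ENNReal.ofReal γ

lemma gauss_pos (t : ℝ) : 0 < gauss t := by unfold gauss; positivity

lemma gauss_cont : Continuous gauss := by unfold gauss; fun_prop

lemma gauss_le (t : ℝ) : gauss t ≤ 1 := by
  unfold gauss
  rw [div_le_one (by positivity)]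
  calc Real.exp (-t ^ 2 / 2) ≤ 1 := by
        rw [Real.exp_le_one_iff]; nlinarith [sq_nonneg t]
    _ ≤ √(2 * π) := by
        rw [Real.one_le_sqrt]; nlinarith [Real.pi_gt_three]

lemma log_gauss (t : ℝ) : Real.log (gauss t) = -t ^ 2 / 2 - Real.log (√(2 * π)) := by
  unfold gauss
  rw [Real.log_div (by positivity) (by positivity), Real.log_exp]

lemma gauss_int : Integrable gauss := by
  unfold gauss
  have := (integrable_exp_neg_mul_sq (b := 1/2) (by norm_num)).div_const (√(2 * π))
  refine this.congr (ae_of_all _ fun t => ?_)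
  dsimp only
  congr 2; ring

lemma gauss_sq_int : Integrable (fun t => gauss t * t ^ 2) := by
  unfold gauss
  have := (integrable_rpow_mul_exp_neg_mul_sq (b := 1/2) (by norm_num) (s := 2) (by norm_num)).div_const (√(2 * π))
  refine this.congr (ae_of_all _ fun t => ?_)
  dsimp only
  rw [show (2:ℝ) = ((2:ℕ):ℝ) by norm_num, Real.rpow_natCast]
  rw [show -(1 / ((2:ℕ):ℝ)) * t ^ 2 = -t^2 / ((2:ℕ):ℝ) by ring]
  ring

lemma gauss_int_x (ν : Measure ℝ) [IsFiniteMeasure ν] (y : ℝ) :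
    Integrable (fun x => gauss (y - x)) ν := by
  refine Integrable.of_bound (C := 1) ?_ (ae_of_all _ fun x => ?_)
  · exact (gauss_cont.comp (by fun_prop)).aestronglyMeasurable
  · rw [Real.norm_of_nonneg (gauss_pos _).le]; exact gauss_le _

lemma outDen_le (ν : Measure ℝ) [IsProbabilityMeasure ν] (y : ℝ) : outDen ν y ≤ 1 := by
  unfold outDen
  calc ∫ x, gauss (y - x) ∂ν ≤ ∫ x, (1:ℝ) ∂ν :=
        integral_mono (gauss_int_x ν y) (integrable_const _) fun x => gauss_le _
    _ = 1 := by simp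

lemma outDen_nonneg (ν : Measure ℝ) (y : ℝ) : 0 ≤ outDen ν y :=
  integral_nonneg fun _ => (gauss_pos _).le

lemma outDen_ge (q : ℝ) (hq0 : 0 < q) (ν : Measure ℝ) [IsProbabilityMeasure ν]
    (h : ENNReal.ofReal q ≤ ν {0}) (y : ℝ) : q * gauss y ≤ outDen ν y := by
  have h1 : ∫ x in ({0} : Set ℝ), gauss (y - x) ∂ν ≤ outDen ν y :=
    setIntegral_le_integral (gauss_int_x ν y) (ae_of_all _ fun x => (gauss_pos _).le)
  rw [integral_singleton] at h1
  refine le_trans ?_ h1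
  simp only [sub_zero, smul_eq_mul]
  refine mul_le_mul_of_nonneg_right ?_ (gauss_pos _).le
  exact (ENNReal.ofReal_le_iff_le_toReal (measure_ne_top _ _)).1 h

lemma outDen_meas (ν : Measure ℝ) [IsProbabilityMeasure ν] : Measurable (outDen ν) := by
  unfold outDen
  have : StronglyMeasurable (Function.uncurry fun y x : ℝ => gauss (y - x)) :=
    (gauss_cont.comp (by fun_prop : Continuous fun p : ℝ × ℝ => p.1 - p.2)).stronglyMeasurable
  exact (this.integral_prod_right (ν := ν)).measurable

/-- the constant in the bound on `log` of the output density -/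
noncomputable def cA (q : ℝ) : ℝ := |Real.log q| + |Real.log (√(2 * π))|

lemma cA_nonneg (q : ℝ) : 0 ≤ cA q := by unfold cA; positivity

lemma log_bound (q : ℝ) (hq0 : 0 < q) (y p : ℝ) (h1 : q * gauss y ≤ p) (h2 : p ≤ 1) :
    |Real.log p| ≤ cA q + y ^ 2 := by
  have h0 : 0 < q * gauss y := mul_pos hq0 (gauss_pos y)
  have hp : 0 < p := h0.trans_le h1
  have h3 : Real.log p ≤ 0 := Real.log_nonpos hp.le h2
  have h4 := Real.log_le_log h0 h1
  rw [Real.log_mul hq0.ne' (gauss_pos y).ne', log_gauss] at h4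
  rw [abs_of_nonpos h3]
  unfold cA
  have := neg_abs_le (Real.log q)
  have := le_abs_self (Real.log (√(2 * π)))
  nlinarith [sq_nonneg y]

lemma prod_int (ν : Measure ℝ) [IsProbabilityMeasure ν]
    (hν : ∫⁻ x, ENNReal.ofReal (x ^ 2) ∂ν < ⊤) (F : ℝ → ℝ) (hF : Measurable F)
    (A : ℝ) (hA : 0 ≤ A) (hb : ∀ y, |F y| ≤ A + y ^ 2) :
    Integrable (fun z : ℝ × ℝ => gauss (z.2 - z.1) * F z.2) (ν.prod volume) := by
  have hsq : Integrable (fun x : ℝ => x ^ 2) ν := by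
    refine ⟨by fun_prop, ?_⟩
    rw [hasFiniteIntegral_iff_ofReal (ae_of_all _ fun x => sq_nonneg x)]
    exact hν
  have hg : Integrable (fun z : ℝ × ℝ =>
      gauss (z.2 - z.1) * (A + 2 * (z.2 - z.1) ^ 2 + 2 * z.1 ^ 2)) (ν.prod volume) := by
    have hc : Continuous (fun z : ℝ × ℝ =>
      gauss (z.2 - z.1) * (A + 2 * (z.2 - z.1) ^ 2 + 2 * z.1 ^ 2)) :=
      (gauss_cont.comp (by fun_prop)).mul (by fun_prop)
    have hi : ∀ x : ℝ, Integrable (fun t =>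
        gauss t * A + 2 * (gauss t * t ^ 2) + gauss t * (2 * x ^ 2)) := fun x =>
      ((gauss_int.mul_const A).add (gauss_sq_int.const_mul 2)).add (gauss_int.mul_const _)
    rw [integrable_prod_iff hc.aestronglyMeasurable]
    constructor
    · refine ae_of_all _ fun x => ?_
      refine ((hi x).comp_sub_right x).congr (ae_of_all _ fun y => ?_)
      dsimp only; ring
    · have hi2 : Integrable (fun t => gauss t * A + 2 * (gauss t * t ^ 2)) :=
        (gauss_int.mul_const A).add (gauss_sq_int.const_mul 2)
      have : ∀ x : ℝ, ∫ y, ‖gauss (y - x) * (A + 2 * (y - x) ^ 2 + 2 * x ^ 2)‖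
          = (∫ t, gauss t * A + 2 * (gauss t * t ^ 2)) + (∫ t, gauss t) * (2 * x ^ 2) := by
        intro x
        rw [integral_sub_right_eq_self
          (fun t => ‖gauss t * (A + 2 * t ^ 2 + 2 * x ^ 2)‖) x,
          ← integral_mul_const, ← integral_add hi2 (gauss_int.mul_const _)]
        refine integral_congr_ae (ae_of_all _ fun t => ?_)
        dsimp only
        rw [Real.norm_of_nonneg (mul_nonneg (gauss_pos _).le (by positivity))]
        ring
      simp only [this]
      exact (integrable_const _).add ((hsq.const_mul 2).const_mul _)
  refine hg.mono' ?_ (ae_of_all _ fun z => ?_)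
  · exact ((gauss_cont.comp (by fun_prop : Continuous fun z : ℝ × ℝ => z.2 - z.1)).measurable.mul
      (hF.comp measurable_snd)).aestronglyMeasurable
  · rw [norm_mul, Real.norm_of_nonneg (gauss_pos _).le, Real.norm_eq_abs]
    refine mul_le_mul_of_nonneg_left ((hb _).trans ?_) (gauss_pos _).le
    nlinarith [sq_nonneg (z.2 - z.1 - z.1)]

lemma marg (ν : Measure ℝ) (F : ℝ → ℝ) (y : ℝ) :
    ∫ x, gauss (y - x) * F y ∂ν = outDen ν y * F y := integral_mul_const _ _

lemma marg_int (ν : Measure ℝ) [IsProbabilityMeasure ν]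
    (hν : ∫⁻ x, ENNReal.ofReal (x ^ 2) ∂ν < ⊤) (F : ℝ → ℝ) (hF : Measurable F)
    (A : ℝ) (hA : 0 ≤ A) (hb : ∀ y, |F y| ≤ A + y ^ 2) :
    Integrable (fun y => outDen ν y * F y) := by
  have := (prod_int ν hν F hF A hA hb).integral_prod_right
  simpa only [marg] using this

lemma swap_int (ν : Measure ℝ) [IsProbabilityMeasure ν]
    (hν : ∫⁻ x, ENNReal.ofReal (x ^ 2) ∂ν < ⊤) (F : ℝ → ℝ) (hF : Measurable F)
    (A : ℝ) (hA : 0 ≤ A) (hb : ∀ y, |F y| ≤ A + y ^ 2) :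
    ∫ x, (∫ y, gauss (y - x) * F y) ∂ν = ∫ y, outDen ν y * F y := by
  have := integral_integral_swap (f := fun x y => gauss (y - x) * F y)
    (prod_int ν hν F hF A hA hb)
  rw [this]
  simp only [marg]

lemma outDen_total (ν : Measure ℝ) [IsProbabilityMeasure ν]
    (hν : ∫⁻ x, ENNReal.ofReal (x ^ 2) ∂ν < ⊤) :
    Integrable (outDen ν) ∧ ∫ y, outDen ν y = ∫ t, gauss t := by
  have hb : ∀ y : ℝ, |(1:ℝ)| ≤ 1 + y ^ 2 := fun y => by
    rw [abs_one]; nlinarith [sq_nonneg y]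
  have h1 := marg_int ν hν (fun _ => 1) measurable_const 1 zero_le_one hb
  have h2 := swap_int ν hν (fun _ => 1) measurable_const 1 zero_le_one hb
  simp only [mul_one] at h1 h2
  refine ⟨h1, ?_⟩
  rw [← h2]
  have : ∀ x : ℝ, ∫ y, gauss (y - x) = ∫ t, gauss t := fun x =>
    integral_sub_right_eq_self gauss x
  simp [this]

lemma glog_int : Integrable (fun t => gauss t * Real.log (gauss t)) := by
  have := (gauss_sq_int.const_mul (-1/2)).sub (gauss_int.mul_const (Real.log (√(2 * π))))
  refine this.congr (ae_of_all _ fun t => ?_)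
  simp only [log_gauss, Pi.sub_apply]; ring

lemma relEnt_avg (q : ℝ) (hq0 : 0 < q) (ν ρ : Measure ℝ) [IsProbabilityMeasure ν]
    [IsProbabilityMeasure ρ]
    (hν : ∫⁻ x, ENNReal.ofReal (x ^ 2) ∂ν < ⊤) (h : ENNReal.ofReal q ≤ ρ {0}) :
    Integrable (fun y => outDen ν y * Real.log (outDen ρ y)) ∧
    ∫ x, relEnt x ρ ∂ν = (∫ t, gauss t * Real.log (gauss t))
      - ∫ y, outDen ν y * Real.log (outDen ρ y) := by
  have hF : Measurable (fun y => Real.log (outDen ρ y)) := (outDen_meas ρ).log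
  have hb : ∀ y, |Real.log (outDen ρ y)| ≤ cA q + y ^ 2 := fun y =>
    log_bound q hq0 y _ (outDen_ge q hq0 ρ h y) (outDen_le ρ y)
  have hP := prod_int ν hν _ hF _ (cA_nonneg q) hb
  refine ⟨marg_int ν hν _ hF _ (cA_nonneg q) hb, ?_⟩
  have hae : ∀ᵐ x ∂ν, relEnt x ρ = (∫ t, gauss t * Real.log (gauss t))
      - ∫ y, gauss (y - x) * Real.log (outDen ρ y) := by
    filter_upwards [hP.prod_right_ae] with x hx
    rw [← integral_sub_right_eq_self (fun t => gauss t * Real.log (gauss t)) x,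
      ← integral_sub (glog_int.comp_sub_right x) hx]
    unfold relEnt
    refine integral_congr_ae (ae_of_all _ fun y => ?_)
    dsimp only
    rw [Real.log_div (gauss_pos _).ne'
      ((mul_pos hq0 (gauss_pos y)).trans_le (outDen_ge q hq0 ρ h y)).ne']
    ring
  rw [integral_congr_ae hae, integral_sub (integrable_const _) hP.integral_prod_left,
    swap_int ν hν _ hF _ (cA_nonneg q) hb]
  simp

lemma slope_bound (a b B : ℝ) (ha : 0 < a) (hb : 0 < b) (hla : |Real.log a| ≤ B)
    (hlb : |Real.log b| ≤ B) :
    |b * Real.log b - a * Real.log a| ≤ |b - a| * (B + 1) := by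
  have k1 : (Real.log a + 1) * (b - a) ≤ b * Real.log b - a * Real.log a := by
    have := Real.log_le_sub_one_of_pos (div_pos ha hb)
    rw [Real.log_div ha.ne' hb.ne'] at this
    have h2 := mul_le_mul_of_nonneg_left this hb.le
    rw [mul_sub b (a / b) 1, mul_div_cancel₀ _ hb.ne'] at h2
    nlinarith
  have k2 : b * Real.log b - a * Real.log a ≤ (Real.log b + 1) * (b - a) := by
    have := Real.log_le_sub_one_of_pos (div_pos hb ha)
    rw [Real.log_div hb.ne' ha.ne'] at this
    have h2 := mul_le_mul_of_nonneg_left this ha.le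
    rw [mul_sub a (b / a) 1, mul_div_cancel₀ _ ha.ne'] at h2
    nlinarith
  have e : ∀ l : ℝ, |l| ≤ B → |(l + 1) * (b - a)| ≤ |b - a| * (B + 1) := by
    intro l hl
    rw [abs_mul, mul_comm]
    refine mul_le_mul_of_nonneg_left ?_ (abs_nonneg _)
    exact (abs_add_le _ _).trans (by rw [abs_one]; linarith)
  rw [abs_le]
  exact ⟨(neg_le_of_abs_le (e _ hla)).trans k1, k2.trans (le_of_abs_le (e _ hlb))⟩

lemma outDen_mix (μ₀ μ : Measure ℝ) [IsProbabilityMeasure μ₀] [IsProbabilityMeasure μ]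
    (θ : ℝ) (h0 : 0 ≤ θ) (h1 : θ ≤ 1) (y : ℝ) :
    outDen (ENNReal.ofReal (1 - θ) • μ₀ + ENNReal.ofReal θ • μ) y
      = outDen μ₀ y + θ * (outDen μ y - outDen μ₀ y) := by
  unfold outDen
  rw [integral_add_measure ((gauss_int_x μ₀ y).smul_measure ENNReal.ofReal_ne_top)
    ((gauss_int_x μ y).smul_measure ENNReal.ofReal_ne_top), integral_smul_measure,
    integral_smul_measure, ENNReal.toReal_ofReal (by linarith), ENNReal.toReal_ofReal h0]
  simp only [smul_eq_mul]; ring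

/-- for probability measures `μ₀, μ` with point mass at least `q` at `0` and finite
second moments, with `μ_θ = (1−θ)μ₀ + θμ`, the one-sided weak derivative of the mutual
information at `μ₀` in the direction `μ` exists and equals `∫ d(x;μ₀) dμ(x) − I(μ₀)`. -/
theorem weak_derivative_mutInfo (q : ℝ) (hq0 : 0 < q) (hq1 : q < 1)
    (μ₀ μ : Measure ℝ) [IsProbabilityMeasure μ₀] [IsProbabilityMeasure μ]
    (h00 : ENNReal.ofReal q ≤ μ₀ {0}) (h0 : ENNReal.ofReal q ≤ μ {0})
    (hm0 : ∫⁻ x, ENNReal.ofReal (x ^ 2) ∂μ₀ < ⊤) (hm : ∫⁻ x, ENNReal.ofReal (x ^ 2) ∂μ < ⊤) :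
    Tendsto
      (fun θ : ℝ =>
        (mutInfo (ENNReal.ofReal (1 - θ) • μ₀ + ENNReal.ofReal θ • μ) - mutInfo μ₀) / θ)
      (nhdsWithin 0 (Set.Ioi 0))
      (nhds ((∫ x, relEnt x μ₀ ∂μ) - mutInfo μ₀)) := by
  have prob : ∀ θ : ℝ, 0 ≤ θ → θ ≤ 1 →
      IsProbabilityMeasure (ENNReal.ofReal (1 - θ) • μ₀ + ENNReal.ofReal θ • μ) := by
    intro θ h1 h2
    refine ⟨?_⟩
    simp only [Measure.coe_add, Measure.coe_smul, Pi.add_apply, Pi.smul_apply, measure_univ,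
      smul_eq_mul, mul_one]
    rw [← ENNReal.ofReal_add (by linarith) h1]
    simp
  have mass : ∀ θ : ℝ, 0 ≤ θ → θ ≤ 1 → ENNReal.ofReal q ≤
      (ENNReal.ofReal (1 - θ) • μ₀ + ENNReal.ofReal θ • μ) {0} := by
    intro θ h1 h2
    simp only [Measure.coe_add, Measure.coe_smul, Pi.add_apply, Pi.smul_apply, smul_eq_mul]
    calc ENNReal.ofReal q = ENNReal.ofReal (1 - θ) * ENNReal.ofReal q
          + ENNReal.ofReal θ * ENNReal.ofReal q := by
          rw [← add_mul, ← ENNReal.ofReal_add (by linarith) h1]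
          simp
      _ ≤ _ := by gcongr
  have mom : ∀ θ : ℝ, ∫⁻ x, ENNReal.ofReal (x ^ 2)
      ∂(ENNReal.ofReal (1 - θ) • μ₀ + ENNReal.ofReal θ • μ) < ⊤ := by
    intro θ
    rw [lintegral_add_measure, lintegral_smul_measure, lintegral_smul_measure]
    exact ENNReal.add_lt_top.2 ⟨ENNReal.mul_lt_top ENNReal.ofReal_lt_top hm0,
      ENNReal.mul_lt_top ENNReal.ofReal_lt_top hm⟩
  set p0 := outDen μ₀ with hp0
  set p1 := outDen μ with hp1
  have g0 := outDen_ge q hq0 μ₀ h00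
  have g1 := outDen_ge q hq0 μ h0
  have l0 := outDen_le μ₀
  have l1 := outDen_le μ
  rw [← hp0] at g0 l0
  rw [← hp1] at g1 l1
  have gp : ∀ y, 0 < q * gauss y := fun y => mul_pos hq0 (gauss_pos y)
  obtain ⟨i00, e00⟩ := relEnt_avg q hq0 μ₀ μ₀ hm0 h00
  obtain ⟨i10, e10⟩ := relEnt_avg q hq0 μ μ₀ hm h00
  obtain ⟨t0, s0⟩ := outDen_total μ₀ hm0
  obtain ⟨t1, s1⟩ := outDen_total μ hm
  rw [← hp0] at i00 e00 i10 e10 t0 s0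
  rw [← hp1] at i10 e10 t1 s1
  -- the limit
  have hlim : (∫ x, relEnt x μ₀ ∂μ) - mutInfo μ₀
      = ∫ y, -((p1 y - p0 y) * (Real.log (p0 y) + 1)) := by
    unfold mutInfo
    rw [e10, e00]
    have : ∀ y, -((p1 y - p0 y) * (Real.log (p0 y) + 1))
        = (p0 y * Real.log (p0 y) - p1 y * Real.log (p0 y)) + (p0 y - p1 y) := fun y => by ring
    simp only [this]
    have j1 : Integrable (fun y => p0 y * Real.log (p0 y) - p1 y * Real.log (p0 y)) :=
      i00.sub i10
    have j2 : Integrable (fun y => p0 y - p1 y) := t0.sub t1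
    rw [integral_add j1 j2, integral_sub i00 i10, integral_sub t0 t1, s0, s1]
    ring
  rw [hlim]
  have hev : ∀ᶠ θ : ℝ in nhdsWithin 0 (Set.Ioi 0), 0 < θ ∧ θ ≤ 1 := by
    filter_upwards [Ioc_mem_nhdsGT (zero_lt_one (α := ℝ))] with θ h
    exact h
  have hquot : (fun θ : ℝ => ∫ y, -(((p0 y + θ * (p1 y - p0 y)) *
        Real.log (p0 y + θ * (p1 y - p0 y)) - p0 y * Real.log (p0 y)) / θ))
      =ᶠ[nhdsWithin 0 (Set.Ioi 0)] (fun θ : ℝ =>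
        (mutInfo (ENNReal.ofReal (1 - θ) • μ₀ + ENNReal.ofReal θ • μ) - mutInfo μ₀) / θ) := by
    filter_upwards [hev] with θ hθ
    have := prob θ hθ.1.le hθ.2
    obtain ⟨i, e⟩ := relEnt_avg q hq0 _ _ (mom θ) (mass θ hθ.1.le hθ.2)
    simp only [outDen_mix μ₀ μ θ hθ.1.le hθ.2] at i e
    rw [← hp0, ← hp1] at i e
    unfold mutInfo
    rw [e, e00, integral_neg, integral_div, integral_sub i i00]
    ring
  refine Tendsto.congr' hquot ?_
  refine tendsto_integral_filter_of_dominated_convergence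
    (fun y => (p0 y + p1 y) * (cA q + 1 + y ^ 2)) ?_ ?_ ?_ ?_
  · refine Eventually.of_forall fun θ => ?_
    have m0 : Measurable p0 := outDen_meas μ₀
    have m1 : Measurable p1 := outDen_meas μ
    have m2 : Measurable (fun y => p0 y + θ * (p1 y - p0 y)) :=
      m0.add ((m1.sub m0).const_mul θ)
    exact (((m2.mul m2.log).sub (m0.mul m0.log)).div_const θ).neg.aestronglyMeasurable
  · filter_upwards [hev] with θ hθ
    refine ae_of_all _ fun y => ?_
    have b1 : q * gauss y ≤ p0 y + θ * (p1 y - p0 y) := by nlinarith [g0 y, g1 y]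
    have b2 : p0 y + θ * (p1 y - p0 y) ≤ 1 := by nlinarith [l0 y, l1 y]
    have hs := slope_bound (p0 y) (p0 y + θ * (p1 y - p0 y)) (cA q + y ^ 2)
      ((gp y).trans_le (g0 y)) ((gp y).trans_le b1)
      (log_bound q hq0 y _ (g0 y) (l0 y)) (log_bound q hq0 y _ b1 b2)
    rw [norm_neg, norm_div, Real.norm_eq_abs, Real.norm_of_nonneg hθ.1.le, div_le_iff₀ hθ.1]
    refine hs.trans ?_
    rw [add_sub_cancel_left, abs_mul, abs_of_pos hθ.1]
    have hd : |p1 y - p0 y| ≤ p0 y + p1 y := by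
      rw [abs_le]; constructor <;> linarith [g0 y, g1 y, gp y]
    have hc := cA_nonneg q
    calc θ * |p1 y - p0 y| * (cA q + y ^ 2 + 1)
        ≤ θ * (p0 y + p1 y) * (cA q + y ^ 2 + 1) := by
          have := hθ.1
          gcongr
      _ = _ := by ring
  · have hb : ∀ y : ℝ, |cA q + 1 + y ^ 2| ≤ cA q + 1 + y ^ 2 := fun y => by
      have hc := cA_nonneg q
      rw [abs_of_nonneg (by positivity)]
    have hc : 0 ≤ cA q + 1 := by linarith [cA_nonneg q]
    have := (marg_int μ₀ hm0 (fun y => cA q + 1 + y ^ 2) (by fun_prop) _ hc hb).add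
      (marg_int μ hm (fun y => cA q + 1 + y ^ 2) (by fun_prop) _ hc hb)
    refine this.congr (ae_of_all _ fun y => ?_)
    simp only [Pi.add_apply, ← hp0, ← hp1]; ring
  · refine ae_of_all _ fun y => ?_
    have hpos : 0 < p0 y := (gp y).trans_le (g0 y)
    have hu : HasDerivAt (fun θ : ℝ => p0 y + θ * (p1 y - p0 y)) (p1 y - p0 y) 0 := by
      simpa using ((hasDerivAt_id (0:ℝ)).mul_const (p1 y - p0 y)).const_add (p0 y)
    have hg : HasDerivAt (fun t : ℝ => t * Real.log t) (Real.log (p0 y) + 1)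
        (p0 y + 0 * (p1 y - p0 y)) := by
      simpa using Real.hasDerivAt_mul_log hpos.ne'
    have hd := (hg.comp (0:ℝ) hu).tendsto_slope_zero_right.neg
    rw [mul_comm] at hd
    refine hd.congr fun θ => ?_
    simp [Function.comp, div_eq_inv_mul]
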